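/- For every h > 0, the integrals I_{−2}(h) = ∫_{β(h)}^{α(h)} (1+y)^{−2} √(h + h y − y²) dy and I_{−1}(h) = ∫_{β(h)}^{α(h)} (1+y)^{−1} √(h + h y − y²) dy are equal, and both equal π h / 2. -/

import Mathlib

open intervalIntegral Real

/-- If `1 - u(y)² = w(y)²` with `w(y) > 0`, then `arcsin ∘ u` has derivative `u'(y) / w(y)`. -/
theorem hasDerivAt_arcsin_comp {u : ℝ → ℝ} {u' w y : ℝ} (hu : HasDerivAt u u' y) (hw : 0 < w)
    (huw : 1 - u y ^ 2 = w ^ 2) : HasDerivAt (fun t => arcsin (u t)) (u' / w) y := by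
  have hw2 : 0 < w ^ 2 := by positivity
  have h1 : u y ≠ -1 := by
    intro H; rw [H] at huw; linarith
  have h2 : u y ≠ 1 := by
    intro H; rw [H] at huw; linarith
  have h3 := (Real.hasDerivAt_arcsin h1 h2).comp y hu
  rw [huw, Real.sqrt_sq hw.le] at h3
  exact h3.congr_deriv (by ring)

section Primitives

variable {h D y : ℝ}

theorem one_add_pos_of_le (hh : 0 < h) (hD : 0 < D) (hD2 : D ^ 2 = h * (4 + h))
    (hy : (h - D) / 2 ≤ y) : 0 < 1 + y := by
  have : D < h + 2 := by nlinarith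
  linarith

theorem quadratic_pos (hD2 : D ^ 2 = h * (4 + h))
    (hy : y ∈ Set.Ioo ((h - D) / 2) ((h + D) / 2)) : 0 < h + h * y - y ^ 2 := by
  nlinarith [mul_pos (sub_pos.2 hy.1) (sub_pos.2 hy.2)]

theorem hasDerivAt_sqrt_quadratic (hQ : 0 < h + h * y - y ^ 2) :
    HasDerivAt (fun t => √(h + h * t - t ^ 2)) ((h - 2 * y) / (2 * √(h + h * y - y ^ 2))) y := by
  refine HasDerivAt.sqrt ?_ hQ.ne'
  have := (((hasDerivAt_id y).const_mul h).const_add h).sub ((hasDerivAt_id y).pow 2)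
  exact this.congr_deriv (by simp)

theorem hasDerivAt_arcsin_linear (hD : 0 < D) (hD2 : D ^ 2 = h * (4 + h))
    (hQ : 0 < h + h * y - y ^ 2) :
    HasDerivAt (fun t => arcsin ((2 * t - h) / D)) (1 / √(h + h * y - y ^ 2)) y := by
  have hs := Real.sqrt_pos.2 hQ
  have hu : HasDerivAt (fun t => (2 * t - h) / D) (2 / D) y := by
    simpa using (((hasDerivAt_id y).const_mul 2).sub_const h).div_const D
  have key := hasDerivAt_arcsin_comp hu (w := 2 * √(h + h * y - y ^ 2) / D) (by positivity) (by
    rw [div_pow, div_pow, mul_pow, Real.sq_sqrt hQ.le]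
    field_simp
    rw [hD2]; ring)
  exact key.congr_deriv (by field_simp)

theorem hasDerivAt_arcsin_inv (hD : 0 < D) (hD2 : D ^ 2 = h * (4 + h)) (hy : 0 < 1 + y)
    (hQ : 0 < h + h * y - y ^ 2) :
    HasDerivAt (fun t => arcsin ((h + 2 - 2 * (1 + t)⁻¹) / D))
      (1 / ((1 + y) * √(h + h * y - y ^ 2))) y := by
  have hs := Real.sqrt_pos.2 hQ
  have hu : HasDerivAt (fun t => (h + 2 - 2 * (1 + t)⁻¹) / D) (2 / (D * (1 + y) ^ 2)) y := by
    have := ((((((hasDerivAt_id y).const_add 1).fun_inv hy.ne').const_mul 2).const_sub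
      (h + 2)).div_const D)
    exact this.congr_deriv (by simp only [id]; field_simp)
  have key := hasDerivAt_arcsin_comp hu
    (w := 2 * √(h + h * y - y ^ 2) / (D * (1 + y))) (by positivity) (by
    rw [div_pow, div_pow, mul_pow, Real.sq_sqrt hQ.le]
    field_simp
    rw [hD2]; ring)
  exact key.congr_deriv (by field_simp)

/-- The integral of a function with a primitive of the form `G + a * arcsin _ + b * arcsin _`,
where `G` vanishes at the end points. -/
theorem integral_eq_of_primitive (hh : 0 < h) (hD : 0 < D) (hD2 : D ^ 2 = h * (4 + h))
    {f G : ℝ → ℝ} {a b : ℝ}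
    (hf : ContinuousOn f (Set.Icc ((h - D) / 2) ((h + D) / 2)))
    (hG : ContinuousOn G (Set.Icc ((h - D) / 2) ((h + D) / 2)))
    (hG0 : G ((h - D) / 2) = 0) (hG1 : G ((h + D) / 2) = 0)
    (hG' : ∀ y ∈ Set.Ioo ((h - D) / 2) ((h + D) / 2), HasDerivAt G
      (f y - a * (1 / √(h + h * y - y ^ 2)) - b * (1 / ((1 + y) * √(h + h * y - y ^ 2)))) y) :
    ∫ y in ((h - D) / 2)..((h + D) / 2), f y = π * (a + b) := by
  have hle : (h - D) / 2 ≤ (h + D) / 2 := by linarith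
  have hpos : ∀ y ∈ Set.Icc ((h - D) / 2) ((h + D) / 2), 1 + y ≠ 0 := fun y hy =>
    (one_add_pos_of_le hh hD hD2 hy.1).ne'
  have hFTC := integral_eq_sub_of_hasDerivAt_of_le hle
    (f := fun t => G t + a * arcsin ((2 * t - h) / D)
      + b * arcsin ((h + 2 - 2 * (1 + t)⁻¹) / D)) (f' := f) ?_ ?_
    (hf.intervalIntegrable_of_Icc hle)
  · have e1 : (2 * ((h + D) / 2) - h) / D = 1 := by field_simp; ring
    have e2 : (2 * ((h - D) / 2) - h) / D = -1 := by field_simp; ring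
    have p1 := hpos _ (Set.right_mem_Icc.2 hle)
    have p2 := hpos _ (Set.left_mem_Icc.2 hle)
    have i1 : (1 + (h + D) / 2)⁻¹ = (h + 2 - D) / 2 :=
      inv_eq_of_mul_eq_one_right (by linear_combination (-1 / 4) * hD2)
    have i2 : (1 + (h - D) / 2)⁻¹ = (h + 2 + D) / 2 :=
      inv_eq_of_mul_eq_one_right (by linear_combination (-1 / 4) * hD2)
    have e3 : (h + 2 - 2 * (1 + (h + D) / 2)⁻¹) / D = 1 := by
      rw [i1]; field_simp; ring
    have e4 : (h + 2 - 2 * (1 + (h - D) / 2)⁻¹) / D = -1 := by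
      rw [i2]; field_simp; ring
    rw [hFTC]
    simp only [e1, e2, e3, e4, hG0, hG1, arcsin_one, arcsin_neg_one]
    ring
  · refine (hG.add (Continuous.continuousOn ?_)).add (continuousOn_const.mul
      (continuous_arcsin.comp_continuousOn ?_))
    · exact continuous_const.mul (continuous_arcsin.comp (by fun_prop))
    · exact ContinuousOn.div_const (continuousOn_const.sub (continuousOn_const.mul
        (ContinuousOn.inv₀ (by fun_prop) hpos))) _
  · intro y hy
    have hQ := quadratic_pos hD2 hy
    have hy1 := one_add_pos_of_le hh hD hD2 hy.1.le
    exact (((hG' y hy).add ((hasDerivAt_arcsin_linear hD hD2 hQ).const_mul a)).add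
      ((hasDerivAt_arcsin_inv hD hD2 hy1 hQ).const_mul b)).congr_deriv (by ring)

theorem continuousOn_zpow_mul_sqrt (hh : 0 < h) (hD : 0 < D) (hD2 : D ^ 2 = h * (4 + h)) (k : ℤ) :
    ContinuousOn (fun y => (1 + y) ^ k * √(h + h * y - y ^ 2))
      (Set.Icc ((h - D) / 2) ((h + D) / 2)) := by
  refine ContinuousOn.mul (ContinuousOn.zpow₀ (by fun_prop) k fun y hy => Or.inl ?_) (by fun_prop)
  exact (one_add_pos_of_le hh hD hD2 hy.1).ne'

theorem sqrt_quadratic_left (hD2 : D ^ 2 = h * (4 + h)) :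
    √(h + h * ((h - D) / 2) - ((h - D) / 2) ^ 2) = 0 := by
  rw [show h + h * ((h - D) / 2) - ((h - D) / 2) ^ 2 = 0 by linear_combination (-1 / 4) * hD2,
    Real.sqrt_zero]

theorem sqrt_quadratic_right (hD2 : D ^ 2 = h * (4 + h)) :
    √(h + h * ((h + D) / 2) - ((h + D) / 2) ^ 2) = 0 := by
  rw [show h + h * ((h + D) / 2) - ((h + D) / 2) ^ 2 = 0 by linear_combination (-1 / 4) * hD2,
    Real.sqrt_zero]

theorem integral_zpow_neg_one_mul_sqrt (hh : 0 < h) (hD : 0 < D) (hD2 : D ^ 2 = h * (4 + h)) :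
    ∫ y in ((h - D) / 2)..((h + D) / 2), (1 + y) ^ (-1 : ℤ) * √(h + h * y - y ^ 2)
      = π * h / 2 := by
  rw [integral_eq_of_primitive hh hD hD2 (continuousOn_zpow_mul_sqrt hh hD hD2 (-1))
    (G := fun y => √(h + h * y - y ^ 2)) (a := (h + 2) / 2) (b := -1) (by fun_prop)
    (sqrt_quadratic_left hD2) (sqrt_quadratic_right hD2)]
  · ring
  · intro y hy
    have hQ := quadratic_pos hD2 hy
    have hy1 := one_add_pos_of_le hh hD hD2 hy.1.le
    have hs := Real.sqrt_pos.2 hQ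
    have hsq := Real.sq_sqrt hQ.le
    refine (hasDerivAt_sqrt_quadratic hQ).congr_deriv ?_
    rw [zpow_neg_one]
    generalize √(h + h * y - y ^ 2) = r at hs hsq ⊢
    field_simp
    linear_combination (-2) * hsq

theorem integral_zpow_neg_two_mul_sqrt (hh : 0 < h) (hD : 0 < D) (hD2 : D ^ 2 = h * (4 + h)) :
    ∫ y in ((h - D) / 2)..((h + D) / 2), (1 + y) ^ (-2 : ℤ) * √(h + h * y - y ^ 2)
      = π * h / 2 := by
  rw [integral_eq_of_primitive hh hD hD2 (continuousOn_zpow_mul_sqrt hh hD hD2 (-2))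
    (G := fun y => -((1 + y) ^ (-1 : ℤ) * √(h + h * y - y ^ 2))) (a := -1) (b := (h + 2) / 2)
    (continuousOn_zpow_mul_sqrt hh hD hD2 (-1)).neg
    (by simp only [sqrt_quadratic_left hD2, mul_zero, neg_zero])
    (by simp only [sqrt_quadratic_right hD2, mul_zero, neg_zero])]
  · ring
  · intro y hy
    have hQ := quadratic_pos hD2 hy
    have hy1 := one_add_pos_of_le hh hD hD2 hy.1.le
    have hs := Real.sqrt_pos.2 hQ
    simp only [zpow_neg_one]
    refine ((((hasDerivAt_id y).const_add 1).fun_inv hy1.ne').mul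
      (hasDerivAt_sqrt_quadratic hQ)).neg.congr_deriv ?_
    rw [zpow_neg, zpow_ofNat]
    simp only [id]
    generalize √(h + h * y - y ^ 2) = r at hs ⊢
    field_simp
    ring

end Primitives

/-- For `h > 0`, with `α(h) = (h + √(h(4+h)))/2` and
`β(h) = (h − √(h(4+h)))/2`, the integrals
`I₋₂(h) = ∫_{β(h)}^{α(h)} (1+y)⁻² √(h + h y − y²) dy` and
`I₋₁(h) = ∫_{β(h)}^{α(h)} (1+y)⁻¹ √(h + h y − y²) dy` are equal, and both equal `π h / 2`. -/
theorem stmt2 (h : ℝ) (hh : 0 < h) :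
    (∫ y in ((h - Real.sqrt (h * (4 + h))) / 2)..((h + Real.sqrt (h * (4 + h))) / 2),
        (1 + y) ^ (-2 : ℤ) * Real.sqrt (h + h * y - y ^ 2))
      = (∫ y in ((h - Real.sqrt (h * (4 + h))) / 2)..((h + Real.sqrt (h * (4 + h))) / 2),
          (1 + y) ^ (-1 : ℤ) * Real.sqrt (h + h * y - y ^ 2)) ∧
    (∫ y in ((h - Real.sqrt (h * (4 + h))) / 2)..((h + Real.sqrt (h * (4 + h))) / 2),
        (1 + y) ^ (-1 : ℤ) * Real.sqrt (h + h * y - y ^ 2))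
      = Real.pi * h / 2 := by
  have hpos : 0 < h * (4 + h) := by positivity
  have hD := Real.sqrt_pos.2 hpos
  have hD2 := Real.sq_sqrt hpos.le
  rw [integral_zpow_neg_two_mul_sqrt hh hD hD2, integral_zpow_neg_one_mul_sqrt hh hD hD2]
  exact ⟨rfl, rfl⟩
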